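/- arXiv:2203.06344 — 3 statements merged into one kernel-verified Lean document; each statement's English description precedes it below -/
import Mathlib

section
/- Let X be a directed space. The following are equivalent: (1) X is core compact, i.e., O(X) is a continuous lattice; (2) Σ C(X), the lattice of closed subsets of X with the Scott topology, is core compact; (3) Σ C(X) is sober and locally compact and the Scott topology on C(X) equals the upper topology on C(X). -/
open Set TopologicalSpace

universe u

variable {X : Type*}

/-- Specialization order: `x ⊑ y` iff `x ∈ cl {y}`. -/
def specLE (t : TopologicalSpace X) (x y : X) : Prop := x ∈ @closure X t {y}

/-- `↑A` with respect to the specialization order. -/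
def upSet (t : TopologicalSpace X) (A : Set X) : Set X := {z | ∃ a ∈ A, specLE t a z}

/-- `↓A` with respect to the specialization order. -/
def downSet (t : TopologicalSpace X) (A : Set X) : Set X := {z | ∃ a ∈ A, specLE t z a}

/-- A directed subset with respect to the specialization order. -/
def DirSet (t : TopologicalSpace X) (D : Set X) : Prop :=
  D.Nonempty ∧ ∀ a ∈ D, ∀ b ∈ D, ∃ c ∈ D, specLE t a c ∧ specLE t b c

/-- `D → x`: every open set containing `x` meets `D`. -/
def DConv (t : TopologicalSpace X) (D : Set X) (x : X) : Prop :=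
  ∀ U : Set X, t.IsOpen U → x ∈ U → (D ∩ U).Nonempty

/-- Directed-open subset. -/
def DirOpen (t : TopologicalSpace X) (U : Set X) : Prop :=
  ∀ D : Set X, DirSet t D → ∀ x ∈ U, DConv t D x → (D ∩ U).Nonempty

/-- A directed space: every directed-open set is open. -/
def DirSpace (t : TopologicalSpace X) : Prop :=
  ∀ U : Set X, DirOpen t U → t.IsOpen U

/-- `x ≪_d y`. -/
def dWay (t : TopologicalSpace X) (x y : X) : Prop :=
  ∀ D : Set X, DirSet t D → DConv t D y → ∃ d ∈ D, specLE t x d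

/-- c-space. -/
def CSpace (t : TopologicalSpace X) : Prop :=
  ∀ (x : X) (U : Set X), t.IsOpen U → x ∈ U → ∃ y ∈ U, x ∈ @interior X t (upSet t {y})

/-- b-space. -/
def BSpace (t : TopologicalSpace X) : Prop :=
  ∀ (x : X) (U : Set X), t.IsOpen U → x ∈ U →
    ∃ y ∈ U, t.IsOpen (upSet t {y}) ∧ x ∈ upSet t {y} ∧ upSet t {y} ⊆ U

/-- locally hypercompact space. -/
def LocallyHypercompact (t : TopologicalSpace X) : Prop :=
  ∀ (U : Set X), t.IsOpen U → ∀ x ∈ U, ∃ F : Set X, F.Finite ∧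
    x ∈ @interior X t (upSet t F) ∧ upSet t F ⊆ U

/-- `s` is the supremum of `A` with respect to the specialization order. -/
def IsSupOf (t : TopologicalSpace X) (A : Set X) (s : X) : Prop :=
  (∀ a ∈ A, specLE t a s) ∧ ∀ y : X, (∀ a ∈ A, specLE t a y) → specLE t s y

/-- Topological ideal: a directed lower set possessing a supremum to which it converges. -/
def TopIdeal (t : TopologicalSpace X) (A : Set X) : Prop :=
  DirSet t A ∧ downSet t A = A ∧ ∃ s : X, IsSupOf t A s ∧ DConv t A s

/-- The set `I_T(X)` of topological ideals. -/
abbrev IT (t : TopologicalSpace X) := {A : Set X // TopIdeal t A}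

/-- The family `Ω(I_T(X))`. -/
def OmegaOpen (t : TopologicalSpace X) (U : Set (IT t)) : Prop :=
  ∀ A : IT t, A ∈ U ↔ ∃ B ∈ U, (∃ x : X, B.1 = downSet t {x}) ∧ B.1 ⊆ A.1

/-- Way-below relation in a complete lattice. -/
def wayBelow {L : Type*} [CompleteLattice L] (a b : L) : Prop :=
  ∀ D : Set L, D.Nonempty → DirectedOn (· ≤ ·) D → b ≤ sSup D → ∃ d ∈ D, a ≤ d

/-- Continuous (complete) lattice. -/
def ContinuousLattice (L : Type*) [CompleteLattice L] : Prop :=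
  ∀ x : L, {a : L | wayBelow a x}.Nonempty ∧ DirectedOn (· ≤ ·) {a : L | wayBelow a x} ∧
    sSup {a : L | wayBelow a x} = x

/-- Completely distributive complete lattice. -/
def CompletelyDistrib (L : Type u) [CompleteLattice L] : Prop :=
  ∀ (ι : Type u) (κ : ι → Type u) (f : (i : ι) → κ i → L),
    (⨅ i, ⨆ j, f i j) = ⨆ g : (i : ι) → κ i, ⨅ i, f i (g i)

/-- `↑F` in a preordered set. -/
def upOf {L : Type*} [Preorder L] (F : Set L) : Set L := {z | ∃ f ∈ F, f ≤ z}

/-- `F ≪ x` for a set `F` in a complete lattice. -/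
def finWay {L : Type*} [CompleteLattice L] (F : Set L) (x : L) : Prop :=
  ∀ D : Set L, D.Nonempty → DirectedOn (· ≤ ·) D → x ≤ sSup D → ∃ d ∈ D, ∃ f ∈ F, f ≤ d

/-- Quasicontinuous complete lattice. -/
def QuasicontinuousLattice (L : Type*) [CompleteLattice L] : Prop :=
  ∀ x : L,
    (∀ F G : Set L, F.Finite → finWay F x → G.Finite → finWay G x →
      ∃ H : Set L, H.Finite ∧ finWay H x ∧ upOf H ⊆ upOf F ∧ upOf H ⊆ upOf G) ∧
    Set.Ici x = ⋂₀ {S : Set L | ∃ F : Set L, F.Finite ∧ finWay F x ∧ S = upOf F}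

/-- Algebraic complete lattice: every element is the sup of the compact elements below it. -/
def AlgebraicLattice (L : Type*) [CompleteLattice L] : Prop :=
  ∀ x : L, sSup {k : L | wayBelow k k ∧ k ≤ x} = x

/-- Scott-open subset of a preordered set. -/
def ScottOpen {L : Type*} [Preorder L] (U : Set L) : Prop :=
  IsUpperSet U ∧ ∀ D : Set L, D.Nonempty → DirectedOn (· ≤ ·) D →
    ∀ s : L, IsLUB D s → s ∈ U → (D ∩ U).Nonempty

/-- The Scott topology. -/
def scottSp (L : Type*) [Preorder L] : TopologicalSpace L :=
  TopologicalSpace.generateFrom {U : Set L | ScottOpen U}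

/-- The upper topology. -/
def upperSp (L : Type*) [Preorder L] : TopologicalSpace L :=
  TopologicalSpace.generateFrom {S : Set L | ∃ a : L, S = (Set.Iic a)ᶜ}

noncomputable instance {X : Type*} [TopologicalSpace X] : TopologicalSpace (Closeds X) :=
  scottSp (Closeds X)

section Lattice

variable {L : Type*} [CompleteLattice L]

theorem wb_le {a b : L} (h : wayBelow a b) : a ≤ b := by
  obtain ⟨d, hd, h'⟩ := h {b} ⟨b, rfl⟩ (by
    rintro x rfl y rfl
    exact ⟨_, rfl, le_rfl, le_rfl⟩) (by simp)
  rw [mem_singleton_iff] at hd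
  exact hd ▸ h'

theorem wb_mono {a a' b b' : L} (h : wayBelow a b) (h1 : a' ≤ a) (h2 : b ≤ b') :
    wayBelow a' b' := by
  intro D hn hd hs
  obtain ⟨d, hd, h'⟩ := h D hn hd (h2.trans hs)
  exact ⟨d, hd, h1.trans h'⟩

theorem wb_sup {a b c : L} (h1 : wayBelow a c) (h2 : wayBelow b c) : wayBelow (a ⊔ b) c := by
  intro D hn hd hs
  obtain ⟨d, hdD, h'⟩ := h1 D hn hd hs
  obtain ⟨e, heD, h''⟩ := h2 D hn hd hs
  obtain ⟨f, hf, hdf, hef⟩ := hd d hdD e heD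
  exact ⟨f, hf, sup_le (h'.trans hdf) (h''.trans hef)⟩

theorem wb_bot (c : L) : wayBelow ⊥ c := by
  rintro D ⟨d, hd⟩ _ _
  exact ⟨d, hd, bot_le⟩

theorem cl_of_sup (h : ∀ x : L, x ≤ sSup {a : L | wayBelow a x}) : ContinuousLattice L := by
  intro x
  refine ⟨⟨⊥, wb_bot x⟩, ?_, le_antisymm (sSup_le fun a ha => wb_le ha) (h x)⟩
  intro a ha b hb
  exact ⟨a ⊔ b, wb_sup ha hb, le_sup_left, le_sup_right⟩

theorem wb_interp (h : ContinuousLattice L) {a b : L} (hab : wayBelow a b) :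
    ∃ c, wayBelow a c ∧ wayBelow c b := by
  obtain ⟨d, ⟨c, hdc, hcb⟩, had⟩ := hab {d | ∃ c, wayBelow d c ∧ wayBelow c b}
    ⟨⊥, ⊥, wb_bot _, wb_bot _⟩ (by
      rintro d ⟨c, h1, h2⟩ d' ⟨c', h1', h2'⟩
      exact ⟨d ⊔ d', ⟨c ⊔ c', wb_sup (wb_mono h1 le_rfl le_sup_left)
        (wb_mono h1' le_rfl le_sup_right), wb_sup h2 h2'⟩, le_sup_left, le_sup_right⟩) (by
      conv_lhs => rw [← (h b).2.2]
      refine sSup_le fun c hc => ?_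
      rw [← (h c).2.2]
      exact sSup_le fun d hd => le_sSup ⟨c, hd, hc⟩)
  exact ⟨c, wb_mono hdc had le_rfl, hcb⟩

theorem lub_sup (a : L) {D : Set L} (hn : D.Nonempty) {s : L} (hs : IsLUB D s) :
    IsLUB ((a ⊔ ·) '' D) (a ⊔ s) := by
  constructor
  · rintro _ ⟨d, hd, rfl⟩
    exact sup_le_sup le_rfl (hs.1 hd)
  · intro u hu
    obtain ⟨d, hd⟩ := hn
    refine sup_le (le_sup_left.trans (hu ⟨d, hd, rfl⟩)) (hs.2 fun e he => ?_)
    exact le_sup_right.trans (hu ⟨e, he, rfl⟩)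

theorem isOpen_scott {P : Type*} [Preorder P] (U : Set P) :
    @IsOpen P (scottSp P) U ↔ ScottOpen U := by
  constructor
  · intro h
    induction h with
    | basic s hs => exact hs
    | univ => exact ⟨isUpperSet_univ, fun D hn _ _ _ _ => by simpa using hn⟩
    | inter s t _ _ hs ht =>
      refine ⟨hs.1.inter ht.1, fun D hn hd l hl hm => ?_⟩
      obtain ⟨a, ha, ha'⟩ := hs.2 D hn hd l hl hm.1
      obtain ⟨b, hb, hb'⟩ := ht.2 D hn hd l hl hm.2
      obtain ⟨c, hc, hac, hbc⟩ := hd a ha b hb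
      exact ⟨c, hc, hs.1 hac ha', ht.1 hbc hb'⟩
    | sUnion S _ hS =>
      refine ⟨isUpperSet_sUnion fun s hs => (hS s hs).1, fun D hn hd l hl hm => ?_⟩
      obtain ⟨s, hs, hls⟩ := hm
      obtain ⟨a, ha, ha'⟩ := (hS s hs).2 D hn hd l hl hls
      exact ⟨a, ha, s, hs, ha'⟩
  · intro h
    exact TopologicalSpace.GenerateOpen.basic _ h

end Lattice

theorem cl_opens {Y : Type*} [TopologicalSpace Y]
    (h : ∀ (U : Opens Y) (x : Y), x ∈ U → ∃ V : Opens Y, x ∈ V ∧ wayBelow V U) :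
    ContinuousLattice (Opens Y) := by
  refine cl_of_sup fun U x hx => ?_
  obtain ⟨V, hxV, hV⟩ := h U x hx
  exact (le_sSup (show V ∈ {a | wayBelow a U} from hV)) hxV

theorem cl_opens' {Y : Type*} [TopologicalSpace Y] (h : ContinuousLattice (Opens Y))
    {U : Opens Y} {x : Y} (hx : x ∈ U) : ∃ V : Opens Y, x ∈ V ∧ wayBelow V U := by
  rw [← (h U).2.2, Opens.mem_sSup] at hx
  obtain ⟨V, hV, hx⟩ := hx
  exact ⟨V, hx, hV⟩

theorem core_of_lc {Y : Type*} [TopologicalSpace Y] [LocallyCompactSpace Y] :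
    ContinuousLattice (Opens Y) := by
  refine cl_opens fun U x hx => ?_
  obtain ⟨K, hK, hKU, hc⟩ := local_compact_nhds (U.isOpen.mem_nhds hx)
  refine ⟨⟨interior K, isOpen_interior⟩, mem_interior_iff_mem_nhds.2 hK, ?_⟩
  intro D hn hd hs
  obtain ⟨d, hd⟩ := hc.elim_directed_cover (fun d : D => (d.1 : Set Y)) (fun d => d.1.isOpen)
    (by
      intro y hy
      have := hs (hKU hy)
      rw [Opens.mem_sSup] at this
      obtain ⟨V, hV, hy⟩ := this
      exact mem_iUnion.2 ⟨⟨V, hV⟩, hy⟩) (by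
      rintro ⟨a, ha⟩ ⟨b, hb⟩
      obtain ⟨c, hc, h1, h2⟩ := hd a ha b hb
      exact ⟨⟨c, hc⟩, h1, h2⟩) (hι := hn.to_subtype)
  exact ⟨d.1, d.2, interior_subset.trans hd⟩

section Main

variable {X : Type*} [t : TopologicalSpace X]

def pcl1 (x : X) : Closeds X := ⟨closure {x}, isClosed_closure⟩

theorem pc_le {x : X} {A : Closeds X} : pcl1 x ≤ A ↔ x ∈ A := by
  constructor
  · intro h
    exact h (subset_closure rfl)
  · intro h
    exact closure_minimal (singleton_subset_iff.2 h) A.isClosed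

def pcl : List X → Closeds X
  | [] => ⊥
  | x :: l => pcl1 x ⊔ pcl l

theorem pcl_le {l : List X} {A : Closeds X} : pcl l ≤ A ↔ ∀ x ∈ l, x ∈ A := by
  induction l with
  | nil => simp [pcl]
  | cons x l ih => simp [pcl, pc_le, ih]

theorem wOpen (hX : DirSpace t) {S : Set (Closeds X)} (hS : ScottOpen S) (A : Closeds X) :
    IsOpen {x | pcl1 x ⊔ A ∈ S} := by
  apply hX
  intro D hD x hx hc
  have hn : D.Nonempty := hD.1
  obtain ⟨_, ⟨d, hd, rfl⟩, hm⟩ := hS.2 ((fun d => pcl1 d ⊔ A) '' D) (hn.image _) (by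
    rintro _ ⟨a, ha, rfl⟩ _ ⟨b, hb, rfl⟩
    obtain ⟨c, hc, h1, h2⟩ := hD.2 a ha b hb
    exact ⟨_, ⟨c, hc, rfl⟩, sup_le_sup (pc_le.2 h1) le_rfl, sup_le_sup (pc_le.2 h2) le_rfl⟩)
    _ (isLUB_sSup _) (by
      refine hS.1 ?_ hx
      refine sup_le (pc_le.2 ?_) ?_
      · by_contra hcon
        obtain ⟨d, hd, hd'⟩ := hc _ (sSup ((fun d => pcl1 d ⊔ A) '' D)).isClosed.isOpen_compl hcon
        exact hd' (pc_le.1 (le_sup_left.trans (le_sSup (⟨d, hd, rfl⟩ :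
          pcl1 d ⊔ A ∈ (fun d => pcl1 d ⊔ A) '' D))))
      · obtain ⟨d, hd⟩ := hn
        exact le_sup_right.trans (le_sSup (⟨d, hd, rfl⟩ :
          pcl1 d ⊔ A ∈ (fun d => pcl1 d ⊔ A) '' D)))
  exact ⟨d, hd, hm⟩

/-- `◇U`. -/
def dia (U : Opens X) : Set (Closeds X) := {A | ∃ x ∈ U, x ∈ A}

theorem dia_eq (U : Opens X) : dia U = (Set.Iic U.compl)ᶜ := by
  ext A
  simp only [dia, mem_ofPred_eq, mem_compl_iff, mem_Iic]
  constructor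
  · rintro ⟨x, hx, hA⟩ h
    exact h hA hx
  · intro h
    by_contra hc
    push Not at hc
    exact h fun x hx hU => hc x hU hx

theorem scott_Iic {P : Type*} [Preorder P] (A : P) : ScottOpen (Set.Iic A)ᶜ := by
  refine ⟨(isLowerSet_Iic A).compl, fun D _ _ s hs hm => ?_⟩
  by_contra hc
  refine hm (hs.2 fun d hd => ?_)
  by_contra h
  exact hc ⟨d, hd, h⟩

theorem scott_dia (U : Opens X) : ScottOpen (dia U) := dia_eq U ▸ scott_Iic _

theorem basic1 (hX : DirSpace t) (h : ContinuousLattice (Opens X)) (l : List X) :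
    ∀ S : Set (Closeds X), ScottOpen S → pcl l ∈ S → ∃ Us : List (Opens X),
      (∀ U ∈ Us, ∃ x ∈ l, x ∈ U) ∧ ∀ A : Closeds X, (∀ U ∈ Us, A ∈ dia U) → A ∈ S := by
  induction l with
  | nil =>
    intro S hS hl
    exact ⟨[], by simp, fun A _ => hS.1 bot_le hl⟩
  | cons x l ih =>
    intro S hS hl
    let W : Closeds X → Opens X := fun A => ⟨{x | pcl1 x ⊔ A ∈ S}, wOpen hX hS A⟩
    have hW : Monotone W := fun A B hAB y hy => hS.1 (sup_le_sup le_rfl hAB) hy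
    obtain ⟨U, hxU, hU⟩ := cl_opens' h (show x ∈ W (pcl l) from hl)
    obtain ⟨Us, h1, h2⟩ := ih {A | wayBelow U (W A)} (by
      refine ⟨fun A B hAB hA => wb_mono hA le_rfl (hW hAB), fun D hn hd s hs hm => ?_⟩
      obtain ⟨c, hc1, hc2⟩ := wb_interp h hm
      obtain ⟨_, ⟨d, hdD, rfl⟩, hcd⟩ := hc2 (W '' D) (hn.image _) (by
        rintro _ ⟨a, ha, rfl⟩ _ ⟨b, hb, rfl⟩
        obtain ⟨c, hc, h1, h2⟩ := hd a ha b hb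
        exact ⟨_, ⟨c, hc, rfl⟩, hW h1, hW h2⟩) (by
        intro y hy
        obtain ⟨_, ⟨d, hdD, rfl⟩, hm⟩ := hS.2 _ (hn.image _) (by
          rintro _ ⟨a, ha, rfl⟩ _ ⟨b, hb, rfl⟩
          obtain ⟨c, hc, h1, h2⟩ := hd a ha b hb
          exact ⟨_, ⟨c, hc, rfl⟩, sup_le_sup le_rfl h1, sup_le_sup le_rfl h2⟩) _
          (lub_sup (pcl1 y) hn hs) hy
        exact (le_sSup (⟨d, hdD, rfl⟩ : W d ∈ W '' D) : W d ≤ sSup (W '' D)) hm)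
      exact ⟨d, hdD, wb_mono hc1 le_rfl hcd⟩) hU
    refine ⟨U :: Us, ?_, ?_⟩
    · intro V hV
      rcases List.mem_cons.1 hV with rfl | hV
      · exact ⟨x, by simp, hxU⟩
      · obtain ⟨y, hy, hyV⟩ := h1 V hV
        exact ⟨y, by simp [hy], hyV⟩
    · intro A hA
      have hA' := wb_le (h2 A fun V hV => hA V (by simp [hV]))
      obtain ⟨y, hyU, hyA⟩ := hA U (by simp)
      have := hA' hyU
      change pcl1 y ⊔ A ∈ S at this
      rwa [sup_eq_right.2 (pc_le.2 hyA)] at this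

theorem basic2 (hX : DirSpace t) (h : ContinuousLattice (Opens X))
    {S : Set (Closeds X)} (hS : ScottOpen S) {F : Closeds X} (hF : F ∈ S) :
    ∃ Us : List (Opens X),
      (∀ U ∈ Us, F ∈ dia U) ∧ ∀ A : Closeds X, (∀ U ∈ Us, A ∈ dia U) → A ∈ S := by
  obtain ⟨_, ⟨l, hl, rfl⟩, hm⟩ := hS.2 (pcl '' {l | ∀ x ∈ l, x ∈ F}) ⟨_, [], by simp, rfl⟩ (by
    rintro _ ⟨l, hl, rfl⟩ _ ⟨m, hm, rfl⟩
    refine ⟨pcl (l ++ m), ⟨l ++ m, ?_, rfl⟩, ?_, ?_⟩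
    · intro x hx
      rcases List.mem_append.1 hx with hx | hx
      · exact hl x hx
      · exact hm x hx
    · exact pcl_le.2 fun x hx => pcl_le.1 le_rfl x (by simp [hx])
    · exact pcl_le.2 fun x hx => pcl_le.1 le_rfl x (by simp [hx])) F (by
    constructor
    · rintro _ ⟨l, hl, rfl⟩
      exact pcl_le.2 hl
    · intro B hB x hx
      exact pcl_le.1 (hB ⟨[x], by simpa using hx, rfl⟩) x (by simp)) hF
  obtain ⟨Us, h1, h2⟩ := basic1 hX h l S hS hm
  refine ⟨Us, fun U hU => ?_, h2⟩
  obtain ⟨x, hx, hxU⟩ := h1 U hU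
  exact ⟨x, hxU, hl x hx⟩

theorem isOpen_cl (S : Set (Closeds X)) : IsOpen S ↔ ScottOpen S := isOpen_scott S

theorem scott_upper (hX : DirSpace t) (h : ContinuousLattice (Opens X)) :
    scottSp (Closeds X) = upperSp (Closeds X) := by
  apply le_antisymm
  · refine le_generateFrom ?_
    rintro _ ⟨a, rfl⟩
    exact (isOpen_scott _).2 (scott_Iic a)
  · intro S hS
    have hS' := (isOpen_scott S).1 hS
    letI := upperSp (Closeds X)
    change IsOpen S
    rw [isOpen_iff_forall_mem_open]
    intro F hF
    obtain ⟨Us, h1, h2⟩ := basic2 hX h hS' hF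
    refine ⟨⋂ U ∈ {U | U ∈ Us}, dia U, fun A hA => h2 A (by simpa using hA), ?_, by simpa using h1⟩
    refine Set.Finite.isOpen_biInter (List.finite_toSet Us) fun U _ => ?_
    exact TopologicalSpace.GenerateOpen.basic _ ⟨_, dia_eq U⟩

theorem sober_cl (hX : DirSpace t) (h : ContinuousLattice (Opens X)) :
    QuasiSober (Closeds X) := by
  refine ⟨fun {S} hS hc => ?_⟩
  have hF : sSup S ∈ S := by
    by_contra hF
    obtain ⟨Us, h1, h2⟩ := basic2 hX h ((isOpen_cl _).1 hc.isOpen_compl) (F := sSup S) hF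
    have key : ∀ Us : List (Opens X), (∀ U ∈ Us, sSup S ∈ dia U) →
        (S ∩ ⋂ U ∈ {U | U ∈ Us}, dia U).Nonempty := by
      intro Us
      induction Us with
      | nil => intro _; simpa using hS.1
      | cons U Us ih =>
        intro hU
        have h1 := ih fun V hV => hU V (by simp [hV])
        have h2 : (S ∩ dia U).Nonempty := by
          by_contra hcon
          have : sSup S ∈ dia U := hU U (by simp)
          rw [dia_eq] at this
          refine this (mem_Iic.2 <| sSup_le fun A hA => ?_)
          by_contra hA'
          exact hcon ⟨A, hA, by rw [dia_eq]; exact hA'⟩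
        obtain ⟨A, hA, hA1, hA2⟩ := hS.2 _ _ ((isOpen_cl _).2 (scott_dia U))
          (Set.Finite.isOpen_biInter (List.finite_toSet Us)
            fun U _ => (isOpen_cl _).2 (scott_dia U)) h2 h1
        refine ⟨A, hA, ?_⟩
        simp only [mem_ofPred_eq, mem_iInter] at hA2 ⊢
        intro V hV
        rcases List.mem_cons.1 hV with rfl | hV
        · exact hA1
        · exact hA2 V hV
    obtain ⟨A, hA, hA'⟩ := key Us h1
    exact h2 A (by simpa using hA') hA
  refine ⟨sSup S, ?_⟩
  apply subset_antisymm
  · exact closure_minimal (singleton_subset_iff.2 hF) hc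
  · intro A hA
    rw [mem_closure_iff]
    intro O hO hAO
    exact ⟨sSup S, ((isOpen_cl _).1 hO).1 (le_sSup hA) hAO, rfl⟩

theorem t0_cl : T0Space (Closeds X) := by
  refine ⟨fun A B hAB => ?_⟩
  have : ∀ A B : Closeds X, Inseparable A B → A ≤ B := by
    intro A B hAB
    by_contra hc
    exact ((hAB.mem_open_iff ((isOpen_cl _).2 (scott_Iic B))).1 hc) (mem_Iic.2 le_rfl)
  exact le_antisymm (this _ _ hAB) (this _ _ hAB.symm)

theorem compact_aux (hX : DirSpace t) (h : ContinuousLattice (Opens X))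
    {K : Set (Opens X)} (hK : IsLowerSet K)
    (hK' : ∀ D : Set (Opens X), D.Nonempty → DirectedOn (· ≤ ·) D → D ⊆ K → sSup D ∈ K) :
    IsCompact {A : Closeds X | A.compl ∈ K} := by
  refine isCompact_generateFrom (T := (inferInstance : TopologicalSpace (Closeds X)))
    (scott_upper hX h) ?_
  intro P hP hc
  by_contra hcon
  push Not at hcon
  let D : Set (Opens X) :=
    {O | ∃ Q : Set (Set (Closeds X)), Q ⊆ P ∧ Q.Finite ∧ O = sSup {V | dia V ∈ Q}}
  have hD : sSup D ∈ K := by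
    apply hK'
    · exact ⟨_, ∅, by simp, by simp, rfl⟩
    · rintro _ ⟨Q, h1, h2, rfl⟩ _ ⟨Q', h1', h2', rfl⟩
      refine ⟨_, ⟨Q ∪ Q', union_subset h1 h1', h2.union h2', rfl⟩, ?_, ?_⟩
      · exact sSup_le_sSup fun V hV => Or.inl hV
      · exact sSup_le_sSup fun V hV => Or.inr hV
    · rintro _ ⟨Q, h1, h2, rfl⟩
      have := hcon Q h1 h2
      obtain ⟨A, hA, hA'⟩ := not_subset.1 this
      refine hK ?_ hA
      refine sSup_le fun V hV x hx => ?_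
      intro hxA
      exact hA' ⟨_, hV, x, hx, hxA⟩
  have hm : (sSup D).compl ∈ {A : Closeds X | A.compl ∈ K} := by
    have e : (sSup D).compl.compl = sSup D := Opens.ext (compl_compl _)
    change (sSup D).compl.compl ∈ K
    rwa [e]
  obtain ⟨S, hS, hmS⟩ := hc hm
  obtain ⟨a, rfl⟩ := hP hS
  have e : (Set.Iic a)ᶜ = dia a.compl := by
    rw [dia_eq, show a.compl.compl = a from Closeds.ext (compl_compl _)]
  refine hmS ?_
  have : a.compl ≤ sSup D := by
    refine le_trans ?_ (le_sSup (⟨{(Set.Iic a)ᶜ}, by simpa using hS, by simp, rfl⟩ :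
      sSup {V | dia V ∈ ({(Set.Iic a)ᶜ} : Set (Set (Closeds X)))} ∈ D))
    exact le_sSup e.symm
  intro x hx
  by_contra hxa
  exact hx (this hxa)

theorem lc_cl (hX : DirSpace t) (h : ContinuousLattice (Opens X)) :
    LocallyCompactSpace (Closeds X) := by
  refine ⟨fun F N hN => ?_⟩
  obtain ⟨S, hSN, hS, hFS⟩ := mem_nhds_iff.1 hN
  obtain ⟨Us, h1, h2⟩ := basic2 hX h ((isOpen_cl _).1 hS) hFS
  have h3 : ∀ U : Opens X, ∃ V : Opens X, wayBelow V U ∧ (U ∈ Us → F ∈ dia V) := by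
    intro U
    by_cases hU : U ∈ Us
    · obtain ⟨x, hx, hxF⟩ := h1 U hU
      obtain ⟨V, hxV, hV⟩ := cl_opens' h hx
      exact ⟨V, hV, fun _ => ⟨x, hxV, hxF⟩⟩
    · exact ⟨⊥, wb_bot _, fun h => absurd h hU⟩
  choose V hV hFV using h3
  refine ⟨{A : Closeds X | A.compl ∈ {O : Opens X | ∀ U ∈ Us, ¬ wayBelow (V U) O}}, ?_, ?_, ?_⟩
  · rw [mem_nhds_iff]
    refine ⟨⋂ U ∈ {U | U ∈ Us}, dia (V U), ?_, ?_, by simpa using hFV⟩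
    · intro A hA U hU hw
      simp only [mem_ofPred_eq, mem_iInter] at hA
      obtain ⟨x, hx, hxA⟩ := hA U hU
      exact wb_le hw hx hxA
    · exact Set.Finite.isOpen_biInter (List.finite_toSet Us)
            fun U _ => (isOpen_cl _).2 (scott_dia _)
  · intro A hA
    refine hSN (h2 A fun U hU => ?_)
    by_contra hc
    refine hA U hU (wb_mono (hV U) le_rfl ?_)
    intro x hx hxA
    exact hc ⟨x, hx, hxA⟩
  · refine compact_aux hX h ?_ ?_
    · intro O O' hO hOK U hU hw
      exact hOK U hU (wb_mono hw le_rfl hO)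
    · intro D hn hd hDK U hU hw
      obtain ⟨c, hc1, hc2⟩ := wb_interp h hw
      obtain ⟨d, hdD, hcd⟩ := hc2 D hn hd le_rfl
      exact hDK hdD U hU (wb_mono hc1 le_rfl hcd)

theorem core_back (hX : DirSpace t) (h : ContinuousLattice (Opens (Closeds X))) :
    ContinuousLattice (Opens X) := by
  refine cl_opens fun U x hx => ?_
  let dd : Opens X → Opens (Closeds X) := fun U => ⟨dia U, (isOpen_cl _).2 (scott_dia U)⟩
  have hdd : Monotone dd := by
    rintro A B hAB C ⟨x, hx, hC⟩
    exact ⟨x, hAB hx, hC⟩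
  obtain ⟨V, hxV, hV⟩ := cl_opens' h (show pcl1 x ∈ dd U from ⟨x, hx, pc_le.1 le_rfl⟩)
  have ho := wOpen hX ((isOpen_cl _).1 V.isOpen) ⊥
  simp only [sup_bot_eq] at ho
  refine ⟨⟨_, ho⟩, hxV, ?_⟩
  intro D hn hd hs
  obtain ⟨_, ⟨d, hdD, rfl⟩, hVd⟩ := hV (dd '' D) (hn.image _) (by
    rintro _ ⟨a, ha, rfl⟩ _ ⟨b, hb, rfl⟩
    obtain ⟨c, hc, h1, h2⟩ := hd a ha b hb
    exact ⟨_, ⟨c, hc, rfl⟩, hdd h1, hdd h2⟩) (by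
    rintro A ⟨y, hy, hyA⟩
    have := hs hy
    rw [Opens.mem_sSup] at this
    obtain ⟨d, hdD, hyd⟩ := this
    have hle : dd d ≤ sSup (dd '' D) := le_sSup ⟨d, hdD, rfl⟩
    exact hle (show A ∈ dia d from ⟨y, hyd, hyA⟩))
  refine ⟨d, hdD, fun y hy => ?_⟩
  obtain ⟨z, hz, hzy⟩ := hVd hy
  have hzy : z ∈ closure {y} := hzy
  obtain ⟨w, hw, hwy⟩ := mem_closure_iff.1 hzy d d.isOpen hz
  exact (mem_singleton_iff.1 hwy) ▸ hw

end Main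

theorem statement16 {X : Type*} [t : TopologicalSpace X] [T0Space X] (hX : DirSpace t) :
    (ContinuousLattice (Opens X) ↔ ContinuousLattice (Opens (Closeds X))) ∧
    (ContinuousLattice (Opens X) ↔
      (T0Space (Closeds X) ∧ QuasiSober (Closeds X) ∧ LocallyCompactSpace (Closeds X) ∧
        scottSp (Closeds X) = upperSp (Closeds X))) := by
  have h13 : ContinuousLattice (Opens X) →
      (T0Space (Closeds X) ∧ QuasiSober (Closeds X) ∧ LocallyCompactSpace (Closeds X) ∧
        scottSp (Closeds X) = upperSp (Closeds X)) := fun h =>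
    ⟨t0_cl, sober_cl hX h, lc_cl hX h, scott_upper hX h⟩
  have h32 : LocallyCompactSpace (Closeds X) → ContinuousLattice (Opens (Closeds X)) :=
    fun _ => core_of_lc
  exact ⟨⟨fun h => h32 (h13 h).2.2.1, core_back hX⟩, h13, fun h => core_back hX (h32 h.2.2.1)⟩
end

section
/- Any retract of a directed space is a directed space: if Y is a directed space, X is a T0 topological space, and there are continuous maps i : X → Y and r : Y → X with r ∘ i = id_X, then X is a directed space. -/
open Set TopologicalSpace

universe u

variable {X : Type*}

theorem statement17 {X Y : Type*} [tX : TopologicalSpace X] [tY : TopologicalSpace Y]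
    [T0Space X] [T0Space Y] (hY : DirSpace tY)
    (i : X → Y) (r : Y → X) (hi : Continuous i) (hr : Continuous r)
    (hri : r ∘ i = id) :
    DirSpace tX := by
  intro U hU
  have key : DirOpen tY (r ⁻¹' U) := by
    intro D hD y hy hc
    have h1 : DirSet tX (r '' D) := by
      refine ⟨hD.1.image r, ?_⟩
      rintro _ ⟨a, ha, rfl⟩ _ ⟨b, hb, rfl⟩
      obtain ⟨c, hc, hac, hbc⟩ := hD.2 a ha b hb
      have mono : ∀ z, specLE tY z c → specLE tX (r z) (r c) := by
        intro z hz
        have h := image_closure_subset_closure_image hr (mem_image_of_mem r hz)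
        rwa [image_singleton] at h
      exact ⟨r c, mem_image_of_mem r hc, mono a hac, mono b hbc⟩
    have h2 : DConv tX (r '' D) (r y) := by
      intro V hV hyV
      obtain ⟨d, hd, hdV⟩ := hc (r ⁻¹' V) (IsOpen.preimage hr hV) hyV
      exact ⟨r d, mem_image_of_mem r hd, hdV⟩
    obtain ⟨_, ⟨d, hd, rfl⟩, hdU⟩ := hU _ h1 (r y) hy h2
    exact ⟨d, hd, hdU⟩
  have ho : IsOpen (r ⁻¹' U) := hY _ key
  have h3 := ho.preimage hi
  rw [← preimage_comp, hri, preimage_id] at h3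
  exact h3
end

section
/- Let L be a continuous lattice. Then the Scott topology on the order dual L^op equals the upper topology on L^op if and only if L^op is lean, i.e., every lower subset of L that is closed in the Scott topology σ(L) is a compact subset of (L^op, σ(L^op)). -/
open Set TopologicalSpace

universe u

variable {X : Type*}

theorem aux_isOpen_iff {M : Type*} [CompleteLattice M] (U : Set M) :
    @IsOpen M (scottSp M) U ↔ ScottOpen U := by
  constructor
  · intro h
    induction h with
    | basic s hs => exact hs
    | univ =>
      refine ⟨isUpperSet_univ, fun D hD _ s _ _ => by simpa using hD⟩
    | inter s t _ _ hs ht =>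
      refine ⟨hs.1.inter ht.1, fun D hD hdir z hz hzm => ?_⟩
      obtain ⟨a, haD, has⟩ := hs.2 D hD hdir z hz hzm.1
      obtain ⟨b, hbD, hbt⟩ := ht.2 D hD hdir z hz hzm.2
      obtain ⟨c, hcD, hac, hbc⟩ := hdir a haD b hbD
      exact ⟨c, hcD, hs.1 hac has, ht.1 hbc hbt⟩
    | sUnion S _ ih =>
      refine ⟨isUpperSet_sUnion fun s hs => (ih s hs).1, fun D hD hdir z hz hzm => ?_⟩
      obtain ⟨s, hs, hzs⟩ := hzm
      obtain ⟨a, haD, has⟩ := (ih s hs).2 D hD hdir z hz hzs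
      exact ⟨a, haD, s, hs, has⟩
  · intro h
    exact TopologicalSpace.GenerateOpen.basic _ h

theorem aux_isClosed_iff {M : Type*} [CompleteLattice M] (C : Set M) :
    @IsClosed M (scottSp M) C ↔ IsLowerSet C ∧
      ∀ D : Set M, D.Nonempty → DirectedOn (· ≤ ·) D → D ⊆ C → sSup D ∈ C := by
  rw [← @isOpen_compl_iff M C (scottSp M), aux_isOpen_iff]
  constructor
  · rintro ⟨h1, h2⟩
    refine ⟨isUpperSet_compl.1 h1, fun D hD hdir hDC => ?_⟩
    by_contra hn
    obtain ⟨a, haD, ha⟩ := h2 D hD hdir _ (isLUB_sSup D) hn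
    exact ha (hDC haD)
  · rintro ⟨h1, h2⟩
    refine ⟨isUpperSet_compl.2 h1, fun D hD hdir s hs hsC => ?_⟩
    by_contra hn
    apply hsC
    rw [← hs.sSup_eq]
    refine h2 D hD hdir fun d hd => ?_
    by_contra hdC
    exact hn ⟨d, hd, hdC⟩

theorem aux_closed_sup {M : Type*} [CompleteLattice M] {C : Set M}
    (hC : @IsClosed M (scottSp M) C) (x : M) :
    @IsClosed M (scottSp M) {y | x ⊔ y ∈ C} := by
  rw [aux_isClosed_iff] at hC ⊢
  refine ⟨fun a b hba ha => hC.1 (sup_le_sup_left hba x) ha, fun D hD hdir hDC => ?_⟩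
  have h := hC.2 ((fun y => x ⊔ y) '' D) (hD.image _) ?_ ?_
  · refine hC.1 ?_ h
    obtain ⟨d, hd⟩ := hD
    refine sup_le (le_sup_left.trans (le_sSup ⟨d, hd, rfl⟩)) (sSup_le fun e he => ?_)
    exact le_sup_right.trans (le_sSup ⟨e, he, rfl⟩)
  · rintro _ ⟨a, ha, rfl⟩ _ ⟨b, hb, rfl⟩
    obtain ⟨c, hc, hac, hbc⟩ := hdir a ha b hb
    exact ⟨_, ⟨c, hc, rfl⟩, sup_le_sup_left hac x, sup_le_sup_left hbc x⟩
  · rintro _ ⟨a, ha, rfl⟩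
    exact hDC ha

/-- Complete lattices are well-filtered in the Scott topology. -/
theorem aux_wellFiltered {M : Type*} [CompleteLattice M] {ι : Type*} [Nonempty ι]
    (K : ι → Set M) (hdir : Directed (· ⊇ ·) K) (hup : ∀ i, IsUpperSet (K i))
    (hcomp : ∀ i, @IsCompact M (scottSp M) (K i)) (C₀ : Set M)
    (hC₀ : @IsClosed M (scottSp M) C₀) (hne : ∀ i, (K i ∩ C₀).Nonempty) :
    ∃ c ∈ C₀, ∀ i, c ∈ K i := by
  letI := scottSp M
  obtain ⟨C, hCC₀, hmin⟩ := zorn_superset_nonempty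
    {C : Set M | IsClosed C ∧ ∀ i, (K i ∩ C).Nonempty} (by
      intro c hcS hchain hcne
      refine ⟨⋂₀ c, ⟨isClosed_sInter fun s hs => (hcS hs).1, fun i => ?_⟩,
        fun s hs => sInter_subset_of_mem hs⟩
      by_contra hemp
      rw [not_nonempty_iff_eq_empty, sInter_eq_iInter] at hemp
      haveI : Nonempty c := hcne.to_subtype
      obtain ⟨s, hs⟩ := (hcomp i).elim_directed_family_closed
        (fun s : c => (s : Set M)) (fun s => (hcS s.2).1) hemp (by
          intro s t
          rcases hchain.total s.2 t.2 with h | h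
          · exact ⟨s, subset_rfl, h⟩
          · exact ⟨t, h, subset_rfl⟩)
      exact ((hcS s.2).2 i).ne_empty hs) C₀ ⟨hC₀, hne⟩
  obtain ⟨hCcl, hCne⟩ := hmin.prop
  have hmin' : ∀ B : Set M, IsClosed B → (∀ i, (K i ∩ B).Nonempty) → B ⊆ C → C ⊆ B :=
    fun B h1 h2 h3 => hmin.le_of_le ⟨h1, h2⟩ h3
  have hC' := (aux_isClosed_iff C).1 hCcl
  -- the down-closure of `K j ∩ C` is everything
  have key : ∀ j, ∀ x ∈ C, ∃ z ∈ K j ∩ C, x ≤ z := by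
    intro j
    refine hmin' {x | ∃ z ∈ K j ∩ C, x ≤ z} ?_ ?_ ?_
    · refine (aux_isClosed_iff _).2 ⟨?_, ?_⟩
      · rintro a b hba ⟨z, hz, haz⟩
        exact ⟨z, hz, hba.trans haz⟩
      · intro D hD hDdir hDC
        haveI : Nonempty D := hD.to_subtype
        have hex : (K j ∩ ⋂ d : D, {y | (d : M) ⊔ y ∈ C}).Nonempty := by
          by_contra hemp
          rw [not_nonempty_iff_eq_empty] at hemp
          obtain ⟨d, hd⟩ := (hcomp j).elim_directed_family_closed
            (fun d : D => {y | (d : M) ⊔ y ∈ C}) (fun d => aux_closed_sup hCcl _) hemp (by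
              intro a b
              obtain ⟨c, hc, hac, hbc⟩ := hDdir a a.2 b b.2
              exact ⟨⟨c, hc⟩, fun y hy => hC'.1 (sup_le_sup_right hac y) hy,
                fun y hy => hC'.1 (sup_le_sup_right hbc y) hy⟩)
          obtain ⟨z, ⟨hzK, hzC⟩, hdz⟩ := hDC d.2
          have : z ∈ (∅ : Set M) := by
            rw [← hd]
            refine ⟨hzK, ?_⟩
            show (d : M) ⊔ z ∈ C
            rwa [sup_eq_right.2 hdz]
          exact this
        obtain ⟨y, hyK, hy⟩ := hex
        rw [mem_iInter] at hy
        have hcl := ((aux_isClosed_iff _).1 (aux_closed_sup hCcl y)).2 D hD hDdir (by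
          intro d hd
          have := hy ⟨d, hd⟩
          show y ⊔ d ∈ C
          rw [sup_comm]
          exact this)
        exact ⟨y ⊔ sSup D, ⟨hup j le_sup_left hyK, hcl⟩, le_sup_right⟩
    · intro i
      obtain ⟨k, hki, hkj⟩ := hdir i j
      obtain ⟨z, hzK, hzC⟩ := hCne k
      exact ⟨z, hki hzK, z, ⟨hkj hzK, hzC⟩, le_rfl⟩
    · rintro x ⟨z, hz, hxz⟩
      exact hC'.1 hxz hz.2
  have hsup : ∀ x ∈ C, ∀ y ∈ C, x ⊔ y ∈ C := by
    intro x hx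
    refine hmin' {y | x ⊔ y ∈ C} (aux_closed_sup hCcl x) ?_ ?_
    · intro i
      obtain ⟨z, hz, hxz⟩ := key i x hx
      refine ⟨z, hz.1, ?_⟩
      show x ⊔ z ∈ C
      rw [sup_eq_right.2 hxz]
      exact hz.2
    · intro y hy
      exact hC'.1 le_sup_right hy
  have hCnonempty : C.Nonempty := by
    obtain ⟨i⟩ := (inferInstance : Nonempty ι)
    exact (hCne i).mono inter_subset_right
  refine ⟨sSup C, hCC₀ (hC'.2 C hCnonempty (fun a ha b hb =>
    ⟨a ⊔ b, hsup a ha b hb, le_sup_left, le_sup_right⟩) subset_rfl), fun i => ?_⟩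
  obtain ⟨z, hzK, hzC⟩ := hCne i
  exact hup i (le_sSup hzC) hzK

theorem aux_wb_le {L : Type*} [CompleteLattice L] {a b : L} (h : wayBelow a b) : a ≤ b := by
  obtain ⟨d, hd, had⟩ := h {b} (singleton_nonempty b) (directedOn_singleton b) (by simp)
  rw [mem_singleton_iff] at hd
  exact hd ▸ had

theorem aux_wb_mono {L : Type*} [CompleteLattice L] {a b c d : L} (h : wayBelow b c)
    (hab : a ≤ b) (hcd : c ≤ d) : wayBelow a d := by
  intro D hD hdir hle
  obtain ⟨e, he, hbe⟩ := h D hD hdir (hcd.trans hle)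
  exact ⟨e, he, hab.trans hbe⟩

theorem aux_interp {L : Type*} [CompleteLattice L] (hL : ContinuousLattice L) {a c : L}
    (h : wayBelow a c) : ∃ b, wayBelow a b ∧ wayBelow b c := by
  obtain ⟨d, ⟨e, hde, hec⟩, had⟩ := h {d | ∃ e, wayBelow d e ∧ wayBelow e c} (by
      obtain ⟨e, he⟩ := (hL c).1
      obtain ⟨d, hd⟩ := (hL e).1
      exact ⟨d, e, hd, he⟩) (by
      rintro d₁ ⟨e₁, hd₁, he₁⟩ d₂ ⟨e₂, hd₂, he₂⟩
      obtain ⟨e, he, h1, h2⟩ := (hL c).2.1 e₁ he₁ e₂ he₂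
      obtain ⟨d, hd, h3, h4⟩ := (hL e).2.1 d₁ (aux_wb_mono hd₁ le_rfl h1) d₂
        (aux_wb_mono hd₂ le_rfl h2)
      exact ⟨d, ⟨e, hd, he⟩, h3, h4⟩) (by
      conv_lhs => rw [← (hL c).2.2]
      refine sSup_le fun e he => ?_
      conv_lhs => rw [← (hL e).2.2]
      exact sSup_le fun d hd => le_sSup ⟨e, hd, he⟩)
  exact ⟨e, aux_wb_mono hde had le_rfl, hec⟩

theorem aux_closed_wb {L : Type*} [CompleteLattice L] (hL : ContinuousLattice L)
    (s : Finset L) : @IsClosed L (scottSp L) {y | ∀ a ∈ s, ¬ wayBelow a y} := by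
  refine (aux_isClosed_iff _).2 ⟨fun y z hzy hy a ha h => hy a ha (aux_wb_mono h le_rfl hzy), ?_⟩
  intro D hD hdir hDC a ha h
  obtain ⟨b, hab, hb⟩ := aux_interp hL h
  obtain ⟨d, hd, hbd⟩ := hb D hD hdir le_rfl
  exact hDC hd a ha (aux_wb_mono hab le_rfl hbd)

theorem aux_scott_le_upper (M : Type*) [CompleteLattice M] : scottSp M ≤ upperSp M := by
  refine le_generateFrom ?_
  rintro _ ⟨a, rfl⟩
  refine (aux_isOpen_iff _).2 ⟨isUpperSet_compl.2 (isLowerSet_Iic a), fun D hD _ s hs hsa => ?_⟩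
  by_contra hn
  apply hsa
  refine hs.2 fun d hd => ?_
  by_contra hda
  exact hn ⟨d, hd, hda⟩

theorem statement19 {L : Type*} [CompleteLattice L] (hL : ContinuousLattice L) :
    scottSp (Lᵒᵈ) = upperSp (Lᵒᵈ) ↔
      ∀ A : Set L, IsLowerSet A → @IsClosed L (scottSp L) A →
        @IsCompact Lᵒᵈ (scottSp Lᵒᵈ) (OrderDual.ofDual ⁻¹' A) := by
  constructor
  · intro heq A hAl hAc
    rw [heq]
    letI := upperSp Lᵒᵈ
    refine isCompact_generateFrom rfl fun P hP hcov => ?_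
    let T : Set L := {a | (Set.Iic (OrderDual.toDual a))ᶜ ∈ P}
    have hT : sSup T ∉ A := by
      intro hTA
      obtain ⟨S, hSP, hS⟩ := hcov (show OrderDual.toDual (sSup T) ∈ OrderDual.ofDual ⁻¹' A from hTA)
      obtain ⟨a, rfl⟩ := hP hSP
      apply hS
      show OrderDual.ofDual a ≤ sSup T
      exact le_sSup hSP
    have hex : ∃ F : Set L, F ⊆ T ∧ F.Finite ∧ sSup F ∉ A := by
      by_contra! hcon
      apply hT
      have := ((aux_isClosed_iff A).1 hAc).2 {d | ∃ F : Set L, F ⊆ T ∧ F.Finite ∧ d = sSup F}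
        ⟨_, ∅, empty_subset _, finite_empty, rfl⟩ (by
          rintro _ ⟨F, hF, hFf, rfl⟩ _ ⟨G, hG, hGf, rfl⟩
          exact ⟨_, ⟨F ∪ G, union_subset hF hG, hFf.union hGf, rfl⟩,
            sSup_le_sSup subset_union_left, sSup_le_sSup subset_union_right⟩) (by
          rintro _ ⟨F, hF, hFf, rfl⟩
          exact hcon F hF hFf)
      refine hAl (sSup_le fun a ha => ?_) this
      exact le_sSup ⟨{a}, singleton_subset_iff.2 ha, finite_singleton a, by simp⟩
    obtain ⟨F, hFT, hFf, hFA⟩ := hex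
    refine ⟨(fun a : L => (Set.Iic (OrderDual.toDual a))ᶜ) '' F, ?_, hFf.image _, ?_⟩
    · rintro _ ⟨a, ha, rfl⟩
      exact hFT ha
    · intro y hy
      by_contra hn
      apply hFA
      refine hAl (sSup_le fun a ha => ?_) hy
      by_contra hay
      exact hn ⟨_, ⟨a, ha, rfl⟩, fun h => hay h⟩
  · intro hlean
    refine le_antisymm (aux_scott_le_upper _) (le_generateFrom ?_)
    intro U hU
    letI := upperSp Lᵒᵈ
    refine isOpen_iff_forall_mem_open.2 fun x hx => ?_
    classical
    let K : Finset {a : L // ¬ a ≤ OrderDual.ofDual x} → Set Lᵒᵈ := fun F =>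
      OrderDual.ofDual ⁻¹' {y | ∀ a ∈ F.image Subtype.val, ¬ wayBelow a y}
    have hlow : ∀ F : Finset L, IsLowerSet {y : L | ∀ a ∈ F, ¬ wayBelow a y} :=
      fun F y z hzy hy a ha h => hy a ha (aux_wb_mono h le_rfl hzy)
    have hex : ∃ F, ¬ (K F ∩ Uᶜ).Nonempty := by
      by_contra! hcon
      obtain ⟨c, hcU, hc⟩ := aux_wellFiltered K
        (by
          intro F G
          refine ⟨F ∪ G, fun y hy a ha => hy a ?_, fun y hy a ha => hy a ?_⟩
          · exact Finset.image_subset_image Finset.subset_union_left ha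
          · exact Finset.image_subset_image Finset.subset_union_right ha)
        (fun F y z hyz hy => hlow _ hyz hy)
        (fun F => hlean _ (hlow _) (aux_closed_wb hL _)) Uᶜ
        (by
          rw [← @isOpen_compl_iff _ _ (scottSp Lᵒᵈ), compl_compl]
          exact (aux_isOpen_iff U).2 hU)
        hcon
      apply hcU
      refine hU.1 (?_ : x ≤ c) hx
      show OrderDual.ofDual c ≤ OrderDual.ofDual x
      rw [← (hL (OrderDual.ofDual c)).2.2]
      refine sSup_le fun a ha => ?_
      by_contra hax
      exact hc {⟨a, hax⟩} a (by simp) ha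
    obtain ⟨F, hF⟩ := hex
    refine ⟨⋂ a ∈ F, (Set.Iic (OrderDual.toDual a.1))ᶜ, ?_, ?_, ?_⟩
    · intro y hy
      by_contra hyU
      refine hF ⟨y, ?_, hyU⟩
      intro a ha h
      obtain ⟨b, hb, rfl⟩ := Finset.mem_image.1 ha
      exact mem_iInter₂.1 hy b hb (aux_wb_le h)
    · exact isOpen_biInter_finset fun a _ => isOpen_generateFrom_of_mem ⟨_, rfl⟩
    · exact mem_iInter₂.2 fun a _ h => a.2 h
end
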